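/- Fix a unit μ ∈ k^×. For every n ≥ 1, the μ-central GMV assignments define a left action of B_n on the k-linear category A^{(n)} by k-linear automorphisms fixing both objects 0 and 1: for each 1 ≤ i ≤ n−1 the assignments a_i ↦ T_i a_{i+1}, a_{i+1} ↦ a_i, a_i^* ↦ a_{i+1}^* T_i^{-1}, a_{i+1}^* ↦ a_i^*, and a_j ↦ a_j, a_j^* ↦ a_j^* for j ≠ i, i+1, respect the defining relations a_j^* a_j = (μ−1)e₁ and hence define a k-linear automorphism σ_i of A^{(n)}, and these automorphisms satisfy the braid relations σ_iσ_{i+1}σ_i = σ_{i+1}σ_iσ_{i+1} and σ_iσ_j = σ_jσ_i for |i−j| ≥ 2. -/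

import Mathlib

/-!
STATEMENT 5: For a unit μ ∈ k^× and every n ≥ 1, the μ-central GMV assignments
respect the defining relations a_j^* a_j = (μ−1)e₁ and hence define k-linear
automorphisms σ_i of A^{(n)} fixing both objects, and these satisfy the braid
relations, giving a left action of B_n on A^{(n)}.
-/

/-- The braid relations among the generators `σ_1, …, σ_m` (indexed by `Fin m`). -/
def braidRels (m : ℕ) : Set (FreeGroup (Fin m)) :=
  {r | (∃ i j : Fin m, (i : ℕ) + 1 = (j : ℕ) ∧
          r = FreeGroup.of i * FreeGroup.of j * FreeGroup.of i *
              (FreeGroup.of j * FreeGroup.of i * FreeGroup.of j)⁻¹) ∨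
       (∃ i j : Fin m, (i : ℕ) + 2 ≤ (j : ℕ) ∧
          r = FreeGroup.of i * FreeGroup.of j * (FreeGroup.of i)⁻¹ * (FreeGroup.of j)⁻¹)}

/-- The braid group `B_n` on `n` strands. -/
abbrev BraidGroup (n : ℕ) : Type := PresentedGroup (braidRels (n - 1))

/-- The standard generator `σ_i` of `B_n`. -/
def braidGen {n : ℕ} (i : Fin (n - 1)) : BraidGroup n := PresentedGroup.of i

/-- Generators of the `k`-category `A^{(n)}` with two objects `{0,1}` (encoded as
a `k`-algebra with idempotents `e₀, e₁`): the identities `e₀, e₁` and the arrows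
`a_i : 1 → 0`, `a_i^* : 0 → 1`. -/
inductive PGen (n : ℕ) : Type
  | e0 : PGen n
  | e1 : PGen n
  | a : Fin n → PGen n
  | as : Fin n → PGen n

variable (k : Type) [CommRing k]

/-- The defining relations of `A^{(n)}`: `e₀, e₁` are orthogonal idempotents
summing to `1` (encoding the two objects), the arrows are placed in the correct
hom-components (`a_i = e₀ a_i e₁`, `a_i^* = e₁ a_i^* e₀`), and the μ-central
relations `a_i^* a_i = (μ − 1) e₁` hold. -/
inductive PRel (μ : k) (n : ℕ) : FreeAlgebra k (PGen n) → FreeAlgebra k (PGen n) → Prop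
  | idem0 : PRel μ n (FreeAlgebra.ι k PGen.e0 * FreeAlgebra.ι k PGen.e0) (FreeAlgebra.ι k PGen.e0)
  | idem1 : PRel μ n (FreeAlgebra.ι k PGen.e1 * FreeAlgebra.ι k PGen.e1) (FreeAlgebra.ι k PGen.e1)
  | orth01 : PRel μ n (FreeAlgebra.ι k PGen.e0 * FreeAlgebra.ι k PGen.e1) 0
  | orth10 : PRel μ n (FreeAlgebra.ι k PGen.e1 * FreeAlgebra.ι k PGen.e0) 0
  | esum : PRel μ n (FreeAlgebra.ι k PGen.e0 + FreeAlgebra.ι k PGen.e1) 1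
  | aL (i : Fin n) :
      PRel μ n (FreeAlgebra.ι k PGen.e0 * FreeAlgebra.ι k (PGen.a i)) (FreeAlgebra.ι k (PGen.a i))
  | aR (i : Fin n) :
      PRel μ n (FreeAlgebra.ι k (PGen.a i) * FreeAlgebra.ι k PGen.e1) (FreeAlgebra.ι k (PGen.a i))
  | asL (i : Fin n) :
      PRel μ n (FreeAlgebra.ι k PGen.e1 * FreeAlgebra.ι k (PGen.as i)) (FreeAlgebra.ι k (PGen.as i))
  | asR (i : Fin n) :
      PRel μ n (FreeAlgebra.ι k (PGen.as i) * FreeAlgebra.ι k PGen.e0) (FreeAlgebra.ι k (PGen.as i))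
  | mu (i : Fin n) :
      PRel μ n (FreeAlgebra.ι k (PGen.as i) * FreeAlgebra.ι k (PGen.a i))
        ((μ - 1) • FreeAlgebra.ι k PGen.e1)

/-- The `k`-category `A^{(n)}` (the μ-central quotient with two objects `{0,1}`),
encoded as a `k`-algebra with idempotents: the `n`-fold coproduct of copies of
`A = A^{(1)}` in the category of `k`-categories with object set `{0,1}`. -/
abbrev PAlg (μ : k) (n : ℕ) : Type := RingQuot (PRel k μ n)

/-- The idempotent `e₀` (identity of the object `0`). -/
noncomputable def e0P (μ : k) (n : ℕ) : PAlg k μ n :=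
  RingQuot.mkAlgHom k (PRel k μ n) (FreeAlgebra.ι k PGen.e0)

/-- The idempotent `e₁` (identity of the object `1`). -/
noncomputable def e1P (μ : k) (n : ℕ) : PAlg k μ n :=
  RingQuot.mkAlgHom k (PRel k μ n) (FreeAlgebra.ι k PGen.e1)

/-- The generating morphism `a_i : 1 → 0`. -/
noncomputable def aP (μ : k) (n : ℕ) (i : Fin n) : PAlg k μ n :=
  RingQuot.mkAlgHom k (PRel k μ n) (FreeAlgebra.ι k (PGen.a i))

/-- The generating morphism `a_i^* : 0 → 1`. -/
noncomputable def asP (μ : k) (n : ℕ) (i : Fin n) : PAlg k μ n :=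
  RingQuot.mkAlgHom k (PRel k μ n) (FreeAlgebra.ι k (PGen.as i))

/-- The invertible endomorphism `T_i = e₀ + a_i a_i^*` of the object `0`. -/
noncomputable def TP (μ : k) (n : ℕ) (i : Fin n) : PAlg k μ n :=
  e0P k μ n + aP k μ n i * asP k μ n i

/-- The inverse `T_i^{-1} = e₀ − μ^{-1} a_i a_i^*` of `T_i` (for `μ` a unit). -/
noncomputable def TinvP (μ : kˣ) (n : ℕ) (i : Fin n) : PAlg k (μ : k) n :=
  e0P k (μ : k) n - ((μ⁻¹ : kˣ) : k) • (aP k (μ : k) n i * asP k (μ : k) n i)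

/-- The strand `i` (as an index in `Fin n`). -/
def lo {n : ℕ} (i : Fin (n - 1)) : Fin n := ⟨i.1, by have := i.isLt; omega⟩
/-- The strand `i+1` (as an index in `Fin n`). -/
def hi {n : ℕ} (i : Fin (n - 1)) : Fin n := ⟨i.1 + 1, by have := i.isLt; omega⟩

/-- The μ-central GMV assignments for the generator `σ_i` acting on `A^{(n)}`:
it fixes both objects `0` and `1` and sends `a_i ↦ T_i a_{i+1}`, `a_{i+1} ↦ a_i`,
`a_i^* ↦ a_{i+1}^* T_i^{-1}`, `a_{i+1}^* ↦ a_i^*`, fixing `a_j, a_j^*` for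
`j ≠ i, i+1`. -/
def IsMuGMVAt (μ : kˣ) (n : ℕ) (i : Fin (n - 1))
    (σ : PAlg k (μ : k) n → PAlg k (μ : k) n) : Prop :=
  σ (e0P k (μ : k) n) = e0P k (μ : k) n ∧
  σ (e1P k (μ : k) n) = e1P k (μ : k) n ∧
  σ (aP k (μ : k) n (lo i)) = TP k (μ : k) n (lo i) * aP k (μ : k) n (hi i) ∧
  σ (aP k (μ : k) n (hi i)) = aP k (μ : k) n (lo i) ∧
  σ (asP k (μ : k) n (lo i)) = asP k (μ : k) n (hi i) * TinvP k μ n (lo i) ∧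
  σ (asP k (μ : k) n (hi i)) = asP k (μ : k) n (lo i) ∧
  (∀ j : Fin n, j ≠ lo i → j ≠ hi i →
    σ (aP k (μ : k) n j) = aP k (μ : k) n j ∧ σ (asP k (μ : k) n j) = asP k (μ : k) n j)

namespace PAlg

variable {k}

section Relations

variable (μ : k) {n : ℕ}

@[simp] lemma e0_mul_e0 : e0P k μ n * e0P k μ n = e0P k μ n := by
  simpa [e0P] using RingQuot.mkAlgHom_rel k (PRel.idem0 (μ := μ) (n := n))

@[simp] lemma e1_mul_e1 : e1P k μ n * e1P k μ n = e1P k μ n := by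
  simpa [e1P] using RingQuot.mkAlgHom_rel k (PRel.idem1 (μ := μ) (n := n))

lemma e0_mul_e1 : e0P k μ n * e1P k μ n = 0 := by
  simpa [e0P, e1P] using RingQuot.mkAlgHom_rel k (PRel.orth01 (μ := μ) (n := n))

lemma e1_mul_e0 : e1P k μ n * e0P k μ n = 0 := by
  simpa [e0P, e1P] using RingQuot.mkAlgHom_rel k (PRel.orth10 (μ := μ) (n := n))

lemma e0_add_e1 : e0P k μ n + e1P k μ n = 1 := by
  simpa [e0P, e1P] using RingQuot.mkAlgHom_rel k (PRel.esum (μ := μ) (n := n))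

@[simp] lemma e0_mul_a (i : Fin n) : e0P k μ n * aP k μ n i = aP k μ n i := by
  simpa [e0P, aP] using RingQuot.mkAlgHom_rel k (PRel.aL (μ := μ) i)

@[simp] lemma a_mul_e1 (i : Fin n) : aP k μ n i * e1P k μ n = aP k μ n i := by
  simpa [e1P, aP] using RingQuot.mkAlgHom_rel k (PRel.aR (μ := μ) i)

@[simp] lemma e1_mul_as (i : Fin n) : e1P k μ n * asP k μ n i = asP k μ n i := by
  simpa [e1P, asP] using RingQuot.mkAlgHom_rel k (PRel.asL (μ := μ) i)

@[simp] lemma as_mul_e0 (i : Fin n) : asP k μ n i * e0P k μ n = asP k μ n i := by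
  simpa [e0P, asP] using RingQuot.mkAlgHom_rel k (PRel.asR (μ := μ) i)

@[simp] lemma as_mul_a (i : Fin n) : asP k μ n i * aP k μ n i = (μ - 1) • e1P k μ n := by
  simpa only [e1P, aP, asP, map_mul, map_smul] using
    RingQuot.mkAlgHom_rel k (PRel.mu (μ := μ) i)

variable {μ} in
/-- Two algebra homomorphisms out of `A^{(n)}` agreeing on the generators are equal. -/
lemma algHom_ext {R : Type*} [Semiring R] [Algebra k R] {f g : PAlg k μ n →ₐ[k] R}
    (h0 : f (e0P k μ n) = g (e0P k μ n)) (h1 : f (e1P k μ n) = g (e1P k μ n))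
    (ha : ∀ i, f (aP k μ n i) = g (aP k μ n i))
    (has : ∀ i, f (asP k μ n i) = g (asP k μ n i)) : f = g := by
  refine RingQuot.ringQuot_ext' k _ _ (FreeAlgebra.hom_ext (funext fun x => ?_))
  cases x with
  | e0 => exact h0
  | e1 => exact h1
  | a i => exact ha i
  | as i => exact has i

/-- The endomorphism of `A^{(n)}` fixing both objects and sending `a_i ↦ f i`,
`a_i^* ↦ g i`. -/
noncomputable def lift (f g : Fin n → PAlg k μ n)
    (hfL : ∀ i, e0P k μ n * f i = f i) (hfR : ∀ i, f i * e1P k μ n = f i)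
    (hgL : ∀ i, e1P k μ n * g i = g i) (hgR : ∀ i, g i * e0P k μ n = g i)
    (hgf : ∀ i, g i * f i = (μ - 1) • e1P k μ n) : PAlg k μ n →ₐ[k] PAlg k μ n :=
  RingQuot.liftAlgHom k ⟨FreeAlgebra.lift k fun
    | .e0 => e0P k μ n
    | .e1 => e1P k μ n
    | .a i => f i
    | .as i => g i, by
    intro x y h
    cases h <;>
      simp [e0_mul_e1, e1_mul_e0, e0_add_e1, hfL, hfR, hgL, hgR, hgf]⟩

section Lift

variable (f g : Fin n → PAlg k μ n)
  (hfL : ∀ i, e0P k μ n * f i = f i) (hfR : ∀ i, f i * e1P k μ n = f i)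
  (hgL : ∀ i, e1P k μ n * g i = g i) (hgR : ∀ i, g i * e0P k μ n = g i)
  (hgf : ∀ i, g i * f i = (μ - 1) • e1P k μ n)

lemma lift_e0 : lift μ f g hfL hfR hgL hgR hgf (e0P k μ n) = e0P k μ n := by
  simp [lift, e0P]

lemma lift_e1 : lift μ f g hfL hfR hgL hgR hgf (e1P k μ n) = e1P k μ n := by
  simp [lift, e1P]

lemma lift_a (i : Fin n) : lift μ f g hfL hfR hgL hgR hgf (aP k μ n i) = f i := by
  simp [lift, aP]

lemma lift_as (i : Fin n) : lift μ f g hfL hfR hgL hgR hgf (asP k μ n i) = g i := by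
  simp [lift, asP]

end Lift

end Relations

section Twist

variable (μ : kˣ) {n : ℕ}

@[simp] lemma e0_mul_T (i : Fin n) : e0P k (μ : k) n * TP k (μ : k) n i = TP k (μ : k) n i := by
  simp [TP, mul_add, ← mul_assoc]

@[simp] lemma T_mul_e0 (i : Fin n) : TP k (μ : k) n i * e0P k (μ : k) n = TP k (μ : k) n i := by
  simp [TP, add_mul, mul_assoc]

@[simp] lemma e0_mul_Tinv (i : Fin n) :
    e0P k (μ : k) n * TinvP k μ n i = TinvP k μ n i := by
  simp [TinvP, mul_sub, ← mul_assoc]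

@[simp] lemma Tinv_mul_e0 (i : Fin n) :
    TinvP k μ n i * e0P k (μ : k) n = TinvP k μ n i := by
  simp [TinvP, sub_mul, mul_assoc]

lemma a_as_mul_a_as (i : Fin n) :
    aP k (μ : k) n i * asP k (μ : k) n i * (aP k (μ : k) n i * asP k (μ : k) n i) =
      ((μ : k) - 1) • (aP k (μ : k) n i * asP k (μ : k) n i) := by
  rw [mul_assoc, ← mul_assoc (asP k (μ : k) n i), as_mul_a, smul_mul_assoc, e1_mul_as,
    mul_smul_comm]

@[simp] lemma T_mul_Tinv (i : Fin n) :
    TP k (μ : k) n i * TinvP k μ n i = e0P k (μ : k) n := by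
  have h : e0P k (μ : k) n * (aP k (μ : k) n i * asP k (μ : k) n i) =
      aP k (μ : k) n i * asP k (μ : k) n i := by rw [← mul_assoc, e0_mul_a]
  have h' : aP k (μ : k) n i * asP k (μ : k) n i * e0P k (μ : k) n =
      aP k (μ : k) n i * asP k (μ : k) n i := by rw [mul_assoc, as_mul_e0]
  rw [TP, TinvP, add_mul, mul_sub, mul_sub, mul_smul_comm, mul_smul_comm, a_as_mul_a_as,
    e0_mul_e0, h, h', smul_smul, mul_sub, Units.inv_mul]
  module

@[simp] lemma Tinv_mul_T (i : Fin n) :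
    TinvP k μ n i * TP k (μ : k) n i = e0P k (μ : k) n := by
  have h : e0P k (μ : k) n * (aP k (μ : k) n i * asP k (μ : k) n i) =
      aP k (μ : k) n i * asP k (μ : k) n i := by rw [← mul_assoc, e0_mul_a]
  have h' : aP k (μ : k) n i * asP k (μ : k) n i * e0P k (μ : k) n =
      aP k (μ : k) n i * asP k (μ : k) n i := by rw [mul_assoc, as_mul_e0]
  rw [TP, TinvP, mul_add, sub_mul, sub_mul, smul_mul_assoc, smul_mul_assoc, a_as_mul_a_as,
    e0_mul_e0, h, h', smul_smul, mul_sub, Units.inv_mul]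
  module

@[simp] lemma T_mul_Tinv_mul (i : Fin n) (x : PAlg k (μ : k) n) :
    TP k (μ : k) n i * (TinvP k μ n i * x) = e0P k (μ : k) n * x := by
  rw [← mul_assoc, T_mul_Tinv]

@[simp] lemma Tinv_mul_T_mul (i : Fin n) (x : PAlg k (μ : k) n) :
    TinvP k μ n i * (TP k (μ : k) n i * x) = e0P k (μ : k) n * x := by
  rw [← mul_assoc, Tinv_mul_T]

@[simp] lemma e0_mul_T_mul (i : Fin n) (x : PAlg k (μ : k) n) :
    e0P k (μ : k) n * (TP k (μ : k) n i * x) = TP k (μ : k) n i * x := by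
  rw [← mul_assoc, e0_mul_T]

@[simp] lemma e0_mul_Tinv_mul (i : Fin n) (x : PAlg k (μ : k) n) :
    e0P k (μ : k) n * (TinvP k μ n i * x) = TinvP k μ n i * x := by
  rw [← mul_assoc, e0_mul_Tinv]

@[simp] lemma e1_mul_as_mul (i : Fin n) (x : PAlg k (μ : k) n) :
    e1P k (μ : k) n * (asP k (μ : k) n i * x) = asP k (μ : k) n i * x := by
  rw [← mul_assoc, e1_mul_as]

/-- The endomorphism of `A^{(n)}` given by the μ-central GMV assignments on the strands
`p` and `q`. -/
noncomputable def twistHom (p q : Fin n) : PAlg k (μ : k) n →ₐ[k] PAlg k (μ : k) n :=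
  lift (μ : k)
    (fun j => if j = p then TP k (μ : k) n p * aP k (μ : k) n q
      else if j = q then aP k (μ : k) n p else aP k (μ : k) n j)
    (fun j => if j = p then asP k (μ : k) n q * TinvP k μ n p
      else if j = q then asP k (μ : k) n p else asP k (μ : k) n j)
    (fun j => by split_ifs <;> simp)
    (fun j => by split_ifs <;> simp [mul_assoc])
    (fun j => by split_ifs <;> simp)
    (fun j => by split_ifs <;> simp [mul_assoc])
    (fun j => by split_ifs <;> simp [mul_assoc])

/-- The endomorphism of `A^{(n)}` inverse to `twistHom μ p q`. -/
noncomputable def twistInvHom (p q : Fin n) : PAlg k (μ : k) n →ₐ[k] PAlg k (μ : k) n :=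
  lift (μ : k)
    (fun j => if j = p then aP k (μ : k) n q
      else if j = q then TinvP k μ n q * aP k (μ : k) n p else aP k (μ : k) n j)
    (fun j => if j = p then asP k (μ : k) n q
      else if j = q then asP k (μ : k) n p * TP k (μ : k) n q else asP k (μ : k) n j)
    (fun j => by split_ifs <;> simp)
    (fun j => by split_ifs <;> simp [mul_assoc])
    (fun j => by split_ifs <;> simp)
    (fun j => by split_ifs <;> simp [mul_assoc])
    (fun j => by split_ifs <;> simp [mul_assoc])

lemma map_T (f : PAlg k (μ : k) n →ₐ[k] PAlg k (μ : k) n) (i : Fin n) :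
    f (TP k (μ : k) n i) =
      f (e0P k (μ : k) n) + f (aP k (μ : k) n i) * f (asP k (μ : k) n i) := by
  rw [TP, map_add, map_mul]

lemma map_Tinv (f : PAlg k (μ : k) n →ₐ[k] PAlg k (μ : k) n) (i : Fin n) :
    f (TinvP k μ n i) = f (e0P k (μ : k) n) -
      ((μ⁻¹ : kˣ) : k) • (f (aP k (μ : k) n i) * f (asP k (μ : k) n i)) := by
  rw [TinvP, map_sub, map_smul, map_mul]

section TwistHom

variable {p q : Fin n}

@[simp] lemma twistHom_e0 : twistHom μ p q (e0P k (μ : k) n) = e0P k (μ : k) n :=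
  lift_e0 ..

@[simp] lemma twistHom_e1 : twistHom μ p q (e1P k (μ : k) n) = e1P k (μ : k) n :=
  lift_e1 ..

lemma twistHom_a (j : Fin n) : twistHom μ p q (aP k (μ : k) n j) =
    if j = p then TP k (μ : k) n p * aP k (μ : k) n q
      else if j = q then aP k (μ : k) n p else aP k (μ : k) n j :=
  lift_a ..

lemma twistHom_as (j : Fin n) : twistHom μ p q (asP k (μ : k) n j) =
    if j = p then asP k (μ : k) n q * TinvP k μ n p
      else if j = q then asP k (μ : k) n p else asP k (μ : k) n j :=
  lift_as ..

lemma twistHom_T (j : Fin n) : twistHom μ p q (TP k (μ : k) n j) =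
    if j = p then TP k (μ : k) n p * (TP k (μ : k) n q * TinvP k μ n p)
      else if j = q then TP k (μ : k) n p else TP k (μ : k) n j := by
  rw [map_T, twistHom_e0, twistHom_a, twistHom_as]
  split_ifs
  · rw [TP.eq_def k (μ : k) n q]
    simp [mul_add, add_mul, mul_assoc]
  · rfl
  · rfl

lemma twistHom_Tinv (j : Fin n) : twistHom μ p q (TinvP k μ n j) =
    if j = p then TP k (μ : k) n p * (TinvP k μ n q * TinvP k μ n p)
      else if j = q then TinvP k μ n p else TinvP k μ n j := by
  rw [map_Tinv, twistHom_e0, twistHom_a, twistHom_as]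
  split_ifs
  · rw [TinvP.eq_def k μ n q]
    simp [mul_sub, sub_mul, mul_assoc]
  · rfl
  · rfl

@[simp] lemma twistInvHom_e0 : twistInvHom μ p q (e0P k (μ : k) n) = e0P k (μ : k) n :=
  lift_e0 ..

@[simp] lemma twistInvHom_e1 : twistInvHom μ p q (e1P k (μ : k) n) = e1P k (μ : k) n :=
  lift_e1 ..

lemma twistInvHom_a (j : Fin n) : twistInvHom μ p q (aP k (μ : k) n j) =
    if j = p then aP k (μ : k) n q
      else if j = q then TinvP k μ n q * aP k (μ : k) n p else aP k (μ : k) n j :=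
  lift_a ..

lemma twistInvHom_as (j : Fin n) : twistInvHom μ p q (asP k (μ : k) n j) =
    if j = p then asP k (μ : k) n q
      else if j = q then asP k (μ : k) n p * TP k (μ : k) n q else asP k (μ : k) n j :=
  lift_as ..

lemma twistInvHom_T_left : twistInvHom μ p q (TP k (μ : k) n p) = TP k (μ : k) n q := by
  simp [twistInvHom_a, twistInvHom_as, TP]

lemma twistInvHom_Tinv_left : twistInvHom μ p q (TinvP k μ n p) = TinvP k μ n q := by
  simp [twistInvHom_a, twistInvHom_as, TinvP]

end TwistHom

/-- The automorphism of `A^{(n)}` given by the μ-central GMV assignments on the distinct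
strands `p` and `q`. -/
noncomputable def twist {p q : Fin n} (hpq : p ≠ q) :
    PAlg k (μ : k) n ≃ₐ[k] PAlg k (μ : k) n :=
  AlgEquiv.ofAlgHom (twistHom μ p q) (twistInvHom μ p q)
    (by
      apply algHom_ext <;> try intro j
      · simp
      · simp
      · by_cases hp : j = p <;> by_cases hq : j = q <;>
          simp_all [twistHom_a, twistHom_Tinv, twistInvHom_a, hpq.symm]
      · by_cases hp : j = p <;> by_cases hq : j = q <;>
          simp_all [twistHom_as, twistHom_T, twistInvHom_as, hpq.symm, mul_assoc])
    (by
      apply algHom_ext <;> try intro j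
      · simp
      · simp
      · by_cases hp : j = p <;> by_cases hq : j = q <;>
          simp_all [twistHom_a, twistInvHom_T_left, twistInvHom_a, hpq.symm]
      · by_cases hp : j = p <;> by_cases hq : j = q <;>
          simp_all [twistHom_as, twistInvHom_Tinv_left, twistInvHom_as, hpq.symm, mul_assoc])

lemma twistHom_braid {p q r : Fin n} (hpq : p ≠ q) (hpr : p ≠ r) (hqr : q ≠ r) :
    (twistHom μ p q).comp ((twistHom μ q r).comp (twistHom μ p q)) =
      (twistHom μ q r).comp ((twistHom μ p q).comp (twistHom μ q r)) := by
  apply algHom_ext <;> try intro j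
  · simp
  · simp
  · by_cases hp : j = p <;> by_cases hq : j = q <;> by_cases hr : j = r <;>
      simp_all [twistHom_a, twistHom_T, hpq.symm, hpr.symm, hqr.symm, mul_assoc]
  · by_cases hp : j = p <;> by_cases hq : j = q <;> by_cases hr : j = r <;>
      simp_all [twistHom_as, twistHom_Tinv, hpq.symm, hpr.symm, hqr.symm, mul_assoc]

lemma twistHom_comm {p q r s : Fin n} (hpr : p ≠ r) (hps : p ≠ s) (hqr : q ≠ r) (hqs : q ≠ s) :
    (twistHom μ p q).comp (twistHom μ r s) = (twistHom μ r s).comp (twistHom μ p q) := by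
  apply algHom_ext <;> try intro j
  · simp
  · simp
  · by_cases hp : j = p <;> by_cases hq : j = q <;> by_cases hr : j = r <;> by_cases hs : j = s <;>
      simp_all [twistHom_a, twistHom_T, hpr.symm, hps.symm, hqr.symm, hqs.symm]
  · by_cases hp : j = p <;> by_cases hq : j = q <;> by_cases hr : j = r <;> by_cases hs : j = s <;>
      simp_all [twistHom_as, twistHom_Tinv, hpr.symm, hps.symm, hqr.symm, hqs.symm]

end Twist

end PAlg

lemma lo_ne_hi {n : ℕ} (i : Fin (n - 1)) : lo i ≠ hi i := by
  simp [lo, hi]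

/-- A family in a group satisfying the braid relations defines a homomorphism from `B_n`. -/
lemma BraidGroup.exists_hom {n : ℕ} {G : Type*} [Group G] (σ : Fin (n - 1) → G)
    (hbraid : ∀ i j : Fin (n - 1), (i : ℕ) + 1 = (j : ℕ) → σ i * σ j * σ i = σ j * σ i * σ j)
    (hcomm : ∀ i j : Fin (n - 1), (i : ℕ) + 2 ≤ (j : ℕ) → σ i * σ j = σ j * σ i) :
    ∃ ρ : BraidGroup n →* G, ∀ i : Fin (n - 1), ρ (braidGen i) = σ i := by
  refine ⟨PresentedGroup.toGroup (f := σ) ?_, fun i => PresentedGroup.toGroup.of _⟩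
  rintro r (⟨i, j, hij, rfl⟩ | ⟨i, j, hij, rfl⟩)
  · simp only [map_mul, map_inv, FreeGroup.lift_apply_of]
    rw [hbraid i j hij, mul_inv_cancel]
  · simp only [map_mul, map_inv, FreeGroup.lift_apply_of]
    rw [hcomm i j hij, mul_inv_cancel_right, mul_inv_cancel]

theorem statement5 (μ : kˣ) (n : ℕ) :
    ∃ σ : Fin (n - 1) → (PAlg k (μ : k) n ≃ₐ[k] PAlg k (μ : k) n),
      -- the assignments respect the relations and define k-linear automorphisms
      -- fixing both objects
      (∀ i : Fin (n - 1), IsMuGMVAt k μ n i (σ i)) ∧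
      -- the braid relations
      (∀ i j : Fin (n - 1), (i : ℕ) + 1 = (j : ℕ) →
        ∀ x, σ i (σ j (σ i x)) = σ j (σ i (σ j x))) ∧
      (∀ i j : Fin (n - 1), (i : ℕ) + 2 ≤ (j : ℕ) →
        ∀ x, σ i (σ j x) = σ j (σ i x)) ∧
      -- hence a left action of B_n on A^{(n)}
      ∃ ρ : BraidGroup n →* (PAlg k (μ : k) n ≃ₐ[k] PAlg k (μ : k) n),
        ∀ i : Fin (n - 1), ρ (braidGen i) = σ i := by
  have hbraid : ∀ i j : Fin (n - 1), (i : ℕ) + 1 = (j : ℕ) → ∀ x,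
      PAlg.twist μ (lo_ne_hi i) (PAlg.twist μ (lo_ne_hi j) (PAlg.twist μ (lo_ne_hi i) x)) =
        PAlg.twist μ (lo_ne_hi j) (PAlg.twist μ (lo_ne_hi i) (PAlg.twist μ (lo_ne_hi j) x)) := by
    intro i j hij
    have hlo : lo j = hi i := Fin.ext hij.symm
    have hne : lo i ≠ hi j := by
      simp only [lo, hi, ne_eq, Fin.mk.injEq]
      omega
    have h : (PAlg.twistHom μ (lo i) (hi i)).comp
        ((PAlg.twistHom μ (lo j) (hi j)).comp (PAlg.twistHom μ (lo i) (hi i))) =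
        (PAlg.twistHom μ (lo j) (hi j)).comp
          ((PAlg.twistHom μ (lo i) (hi i)).comp (PAlg.twistHom μ (lo j) (hi j))) := by
      rw [hlo]
      exact PAlg.twistHom_braid μ (lo_ne_hi i) hne (hlo ▸ lo_ne_hi j)
    exact DFunLike.congr_fun h
  have hcomm : ∀ i j : Fin (n - 1), (i : ℕ) + 2 ≤ (j : ℕ) → ∀ x,
      PAlg.twist μ (lo_ne_hi i) (PAlg.twist μ (lo_ne_hi j) x) =
        PAlg.twist μ (lo_ne_hi j) (PAlg.twist μ (lo_ne_hi i) x) := by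
    intro i j hij
    refine DFunLike.congr_fun (PAlg.twistHom_comm μ ?_ ?_ ?_ ?_) <;>
    · simp only [lo, hi, ne_eq, Fin.mk.injEq]
      omega
  refine ⟨fun i => PAlg.twist μ (lo_ne_hi i), fun i => ?_, hbraid, hcomm,
    BraidGroup.exists_hom _ (fun i j hij => AlgEquiv.ext (hbraid i j hij))
      (fun i j hij => AlgEquiv.ext (hcomm i j hij))⟩
  have hne := (lo_ne_hi i).symm
  refine ⟨PAlg.twistHom_e0 μ, PAlg.twistHom_e1 μ, (PAlg.twistHom_a μ _).trans ?_,
    (PAlg.twistHom_a μ _).trans ?_, (PAlg.twistHom_as μ _).trans ?_,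
    (PAlg.twistHom_as μ _).trans ?_, fun j hlo hhi =>
      ⟨(PAlg.twistHom_a μ _).trans ?_, (PAlg.twistHom_as μ _).trans ?_⟩⟩ <;> simp [*]
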